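/- For every n ≥ 0, the differential operator R applied to g_n gives a monomial: R g_n(z) = −((a_1)_{n+1}⋯(a_p)_{n+1}/(n!(b_1)_n⋯(b_q)_n)) · z^n (identity of polynomials in z). -/

import Mathlib

open Complex Finset Polynomial

/-- The Pochhammer symbol `(c)_k = c (c+1) ⋯ (c+k-1)`. -/
noncomputable def poch (c : ℂ) (k : ℕ) : ℂ := ∏ i ∈ Finset.range k, (c + (i : ℂ))

/-- Coefficient of `z^k` in the generalized hypergeometric series. -/
noncomputable def hypCoeff (p q : ℕ) (a : Fin p → ℂ) (b : Fin q → ℂ) (k : ℕ) : ℂ :=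
  (∏ j, poch (a j) k) / ((∏ l, poch (b l) k) * (k.factorial : ℂ))

/-- The polynomial `g_n`: the `n`-th partial sum of the generalized hypergeometric series. -/
noncomputable def gPoly (p q : ℕ) (a : Fin p → ℂ) (b : Fin q → ℂ) (n : ℕ) : Polynomial ℂ :=
  ∑ k ∈ Finset.range (n + 1), Polynomial.C (hypCoeff p q a b k) * Polynomial.X ^ k

/-- The operator `θ = z d/dz` on polynomials. -/
noncomputable def thetaOp (f : Polynomial ℂ) : Polynomial ℂ :=
  Polynomial.X * Polynomial.derivative f

/-- The composition `∏_j (θ + c_j)` of the commuting operators `θ + c_j`. -/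
noncomputable def shiftProd : List ℂ → Polynomial ℂ → Polynomial ℂ
  | [], f => f
  | c :: cs, f => shiftProd cs (thetaOp f + Polynomial.C c * f)

/-- The operator `R = (d/dz) ∘ ∏_{j=1}^q (θ + b_j - 1) - ∏_{j=1}^p (a_j + θ)`. -/
noncomputable def Rop (p q : ℕ) (a : Fin p → ℂ) (b : Fin q → ℂ) (f : Polynomial ℂ) :
    Polynomial ℂ :=
  Polynomial.derivative (shiftProd (List.ofFn (fun l => b l - 1)) f)
    - shiftProd (List.ofFn a) f

theorem poch_succ (c : ℂ) (k : ℕ) : poch c (k + 1) = poch c k * (c + k) :=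
  Finset.prod_range_succ _ _

theorem poch_ne_zero {c : ℂ} (hc : ∀ m : ℕ, c ≠ -(m : ℂ)) (k : ℕ) : poch c k ≠ 0 :=
  Finset.prod_ne_zero_iff.2 fun i _ h => hc i (eq_neg_of_add_eq_zero_left h)

theorem shiftProd_add (cs : List ℂ) (f g : Polynomial ℂ) :
    shiftProd cs (f + g) = shiftProd cs f + shiftProd cs g := by
  induction cs generalizing f g with
  | nil => rfl
  | cons c cs ih =>
    simp only [shiftProd, thetaOp]
    rw [← ih]
    congr 1
    rw [derivative_add]
    ring

theorem thetaOp_C_mul_X_pow (x : ℂ) (k : ℕ) :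
    thetaOp (C x * X ^ k) = C ((k : ℂ) * x) * X ^ k := by
  cases k with
  | zero => simp [thetaOp]
  | succ k =>
    simp only [thetaOp, derivative_C_mul_X_pow, Nat.add_sub_cancel, C_mul]
    ring

theorem shiftProd_C_mul_X_pow (cs : List ℂ) (x : ℂ) (k : ℕ) :
    shiftProd cs (C x * X ^ k) = C ((cs.map (· + (k : ℂ))).prod * x) * X ^ k := by
  induction cs generalizing x with
  | nil => simp [shiftProd]
  | cons c cs ih =>
    have h : thetaOp (C x * X ^ k) + C c * (C x * X ^ k) = C ((c + k) * x) * X ^ k := by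
      rw [thetaOp_C_mul_X_pow]
      simp only [C_mul, C_add]
      ring
    rw [shiftProd, h, ih, List.map_cons, List.prod_cons]
    congr 2
    ring

theorem shiftProd_ofFn_C_mul_X_pow {m : ℕ} (c : Fin m → ℂ) (x : ℂ) (k : ℕ) :
    shiftProd (List.ofFn c) (C x * X ^ k) = C ((∏ j, (c j + k)) * x) * X ^ k := by
  rw [shiftProd_C_mul_X_pow, List.map_ofFn, List.prod_ofFn]
  rfl

theorem Rop_add (p q : ℕ) (a : Fin p → ℂ) (b : Fin q → ℂ) (f g : Polynomial ℂ) :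
    Rop p q a b (f + g) = Rop p q a b f + Rop p q a b g := by
  simp only [Rop, shiftProd_add, derivative_add]
  ring

theorem Rop_C_mul_X_pow (p q : ℕ) (a : Fin p → ℂ) (b : Fin q → ℂ) (x : ℂ) (k : ℕ) :
    Rop p q a b (C x * X ^ k) =
      C ((∏ l, (b l - 1 + k)) * x * k) * X ^ (k - 1) - C ((∏ j, (a j + k)) * x) * X ^ k := by
  rw [Rop, shiftProd_ofFn_C_mul_X_pow, shiftProd_ofFn_C_mul_X_pow, derivative_C_mul_X_pow]

theorem gPoly_succ (p q : ℕ) (a : Fin p → ℂ) (b : Fin q → ℂ) (n : ℕ) :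
    gPoly p q a b (n + 1) = gPoly p q a b n + C (hypCoeff p q a b (n + 1)) * X ^ (n + 1) :=
  Finset.sum_range_succ _ _

theorem prod_add_mul_hypCoeff (p q : ℕ) (a : Fin p → ℂ) (b : Fin q → ℂ) (k : ℕ) :
    (∏ j, (a j + k)) * hypCoeff p q a b k =
      (∏ j, poch (a j) (k + 1)) / ((k.factorial : ℂ) * ∏ l, poch (b l) k) := by
  simp only [hypCoeff, poch_succ, Finset.prod_mul_distrib]
  ring

theorem prod_sub_one_add_mul_hypCoeff_succ (p q : ℕ) (a : Fin p → ℂ) (b : Fin q → ℂ)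
    (hb : ∀ l, ∀ m : ℕ, b l ≠ -(m : ℂ)) (k : ℕ) :
    (∏ l, (b l - 1 + (k + 1 : ℕ))) * hypCoeff p q a b (k + 1) * (k + 1 : ℕ) =
      (∏ j, poch (a j) (k + 1)) / ((k.factorial : ℂ) * ∏ l, poch (b l) k) := by
  have hshift : ∏ l, (b l - 1 + (k + 1 : ℕ)) = ∏ l, (b l + k) :=
    Finset.prod_congr rfl fun l _ => by push_cast; ring
  have hlin : ∏ l, (b l + k) ≠ 0 :=
    Finset.prod_ne_zero_iff.2 fun l _ h => hb l k (eq_neg_of_add_eq_zero_left h)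
  have hpoch : ∏ l, poch (b l) k ≠ 0 :=
    Finset.prod_ne_zero_iff.2 fun l _ => poch_ne_zero (hb l) k
  have hfact : (k.factorial : ℂ) ≠ 0 := Nat.cast_ne_zero.2 k.factorial_ne_zero
  have hk : ((k + 1 : ℕ) : ℂ) ≠ 0 := Nat.cast_ne_zero.2 k.succ_ne_zero
  have hden : ∏ l, poch (b l) (k + 1) = (∏ l, poch (b l) k) * ∏ l, (b l + k) := by
    simp only [poch_succ, Finset.prod_mul_distrib]
  rw [hypCoeff, hshift, hden, Nat.factorial_succ, Nat.cast_mul]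
  field_simp

theorem stmt2 (p q : ℕ) (a : Fin p → ℂ) (b : Fin q → ℂ)
    (ha : ∀ j, ∀ m : ℕ, a j ≠ -(m : ℂ)) (hb : ∀ l, ∀ m : ℕ, b l ≠ -(m : ℂ)) :
    ∀ n : ℕ,
      Rop p q a b (gPoly p q a b n)
        = Polynomial.C (-(∏ j, poch (a j) (n + 1)) /
            ((n.factorial : ℂ) * ∏ l, poch (b l) n)) * Polynomial.X ^ n := by
  intro n
  induction n with
  | zero =>
    have h : gPoly p q a b 0 = C (hypCoeff p q a b 0) * X ^ 0 := by simp [gPoly]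
    rw [h, Rop_C_mul_X_pow, prod_add_mul_hypCoeff, neg_div, C_neg]
    simp
  | succ n ih =>
    rw [gPoly_succ, Rop_add, ih, Rop_C_mul_X_pow, prod_sub_one_add_mul_hypCoeff_succ p q a b hb,
      prod_add_mul_hypCoeff, neg_div, neg_div, C_neg, C_neg, Nat.add_sub_cancel]
    ring
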